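/- Let 0 ≤ α < 1 and ϖ > 0. Set W = √(α² + 6αϖ + ϖ² + 8ϖ) and define 𝒦(ϖ) = −(9/16)·{ −4·(α+1)·log(W + 3α + ϖ + 4) − 4·( α·(W + 2ϖ + 1) + W + α² + 3ϖ )/(W + α + ϖ) + 4·α·log √((W + α + ϖ)/√ϖ) + 8 + 16·log 2 }. Then, with t := −(2/3)·ϖ·𝒦′(ϖ), one has 64·t² − 9·α² = ϖ·(54α + 48t + 72). -/

import Mathlib

/-- The Kähler potential `𝒦_{F₂}(ϖ,α)` of the Kronheimer Kähler metric on the second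
Hirzebruch surface `F₂`, as a function of the invariant `ϖ = (1+|u|²)²|v|²`, with
`W = √(α² + 6αϖ + ϖ² + 8ϖ)`. -/
noncomputable def KF₂ (α ϖ : ℝ) : ℝ :=
  -(9 / 16) *
    (-4 * (α + 1) *
        Real.log (Real.sqrt (α ^ 2 + 6 * α * ϖ + ϖ ^ 2 + 8 * ϖ) + 3 * α + ϖ + 4)
      - 4 * (α * (Real.sqrt (α ^ 2 + 6 * α * ϖ + ϖ ^ 2 + 8 * ϖ) + 2 * ϖ + 1)
              + Real.sqrt (α ^ 2 + 6 * α * ϖ + ϖ ^ 2 + 8 * ϖ) + α ^ 2 + 3 * ϖ) /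
          (Real.sqrt (α ^ 2 + 6 * α * ϖ + ϖ ^ 2 + 8 * ϖ) + α + ϖ)
      + 4 * α *
          Real.log (Real.sqrt
            ((Real.sqrt (α ^ 2 + 6 * α * ϖ + ϖ ^ 2 + 8 * ϖ) + α + ϖ) / Real.sqrt ϖ))
      + 8 + 16 * Real.log 2)

/-- The derivative of `KF₂ α` collapses to `-(9 / 16) * (ϖ - W) / ϖ`. -/
theorem hasDerivAt_KF₂ {α x : ℝ} (hα : 0 ≤ α) (hx : 0 < x) :
    HasDerivAt (KF₂ α)
      (-(9 / 16) * ((x - Real.sqrt (α ^ 2 + 6 * α * x + x ^ 2 + 8 * x)) / x)) x := by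
  have hR : 0 < α ^ 2 + 6 * α * x + x ^ 2 + 8 * x := by positivity
  have hW₀ := Real.sqrt_pos.2 hR
  have hW₂ := Real.sq_sqrt hR.le
  have hpoly : HasDerivAt (fun y : ℝ => α ^ 2 + 6 * α * y + y ^ 2 + 8 * y)
      (2 * (3 * α + x + 4)) x := by
    refine ((((hasDerivAt_id' x).const_mul (6 * α)).const_add (α ^ 2)).add
      (hasDerivAt_pow 2 x) |>.add ((hasDerivAt_id' x).const_mul 8)).congr_deriv ?_
    norm_num
    ring
  have hW := hpoly.sqrt hR.ne'
  unfold KF₂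
  set w : ℝ → ℝ := fun y => Real.sqrt (α ^ 2 + 6 * α * y + y ^ 2 + 8 * y)
  change 0 < w x at hW₀
  change w x ^ 2 = _ at hW₂
  change HasDerivAt w (2 * (3 * α + x + 4) / (2 * w x)) x at hW
  have hid := hasDerivAt_id' x
  have hA : 0 < w x + 3 * α + x + 4 := by positivity
  have hD : 0 < w x + α + x := by positivity
  have hsx := Real.sqrt_pos.2 hx
  have hsx₂ := Real.sq_sqrt hx.le
  have hlog₁ := (((hW.add_const (3 * α)).add hid).add_const 4).log hA.ne'
  have hDen := (hW.add_const α).add hid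
  have hNum := (((((hW.add (hid.const_mul 2)).add_const 1).const_mul α).add hW).add_const
    (α ^ 2)).add (hid.const_mul 3)
  have hQ : 0 < (w x + α + x) / Real.sqrt x := by positivity
  have hlog₂ := ((hDen.div (hid.sqrt hx.ne') hsx.ne').sqrt hQ.ne').log
    (Real.sqrt_pos.2 hQ).ne'
  have key := ((((hlog₁.const_mul (-4 * (α + 1))).sub
    ((hNum.const_mul 4).div hDen hD.ne')).add (hlog₂.const_mul (4 * α))).add_const
      8).add_const (16 * Real.log 2) |>.const_mul (-(9 / 16))
  refine key.congr_deriv ?_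
  simp only [Pi.add_apply, Pi.div_apply]
  change _ = -(9 / 16) * ((x - w x) / x)
  congr 1
  generalize w x = W at *
  generalize Real.sqrt x = s at *
  have h₁ : (2 * (3 * α + x + 4) / (2 * W) + 1) / (W + 3 * α + x + 4) = 1 / W := by
    field_simp
    ring
  have h₂ : (2 * (3 * α + x + 4) / (2 * W) + 1) / (W + α + x) = (W + x - α) / (2 * x * W) := by
    field_simp
    linear_combination -hW₂
  have h₃ : ((2 * (3 * α + x + 4) / (2 * W) + 1) * s - (W + α + x) * (1 / (2 * s))) / s ^ 2 /
        (2 * Real.sqrt ((W + α + x) / s)) / Real.sqrt ((W + α + x) / s) =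
      1 / 2 * ((2 * (3 * α + x + 4) / (2 * W) + 1) / (W + α + x) - 1 / (2 * x)) := by
    rw [div_div, mul_assoc, Real.mul_self_sqrt hQ.le, ← hsx₂]
    field_simp
  have h₄ : (4 * (α * (2 * (3 * α + x + 4) / (2 * W) + 2 * 1) + 2 * (3 * α + x + 4) / (2 * W) +
          3 * 1) * (W + α + x) -
        4 * (α * (W + 2 * x + 1) + W + α ^ 2 + 3 * x) * (2 * (3 * α + x + 4) / (2 * W) + 1)) /
        (W + α + x) ^ 2 = (3 * α + x + 4) / W - 1 := by
    field_simp
    linear_combination (W + 3 * α + x + 4) * hW₂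
  rw [h₁, h₃, h₄, h₂]
  field_simp
  linear_combination 4 * hW₂

/-- Let `0 ≤ α < 1` and `ϖ > 0`.  With `t := −(2/3)·ϖ·𝒦′(ϖ)`,
one has `64t² − 9α² = ϖ·(54α + 48t + 72)`. -/
theorem stmt_13 (α : ℝ) (hα₀ : 0 ≤ α) (hα₁ : α < 1) (ϖ : ℝ) (hϖ : 0 < ϖ) :
    64 * (-(2 / 3) * ϖ * deriv (KF₂ α) ϖ) ^ 2 - 9 * α ^ 2 =
      ϖ * (54 * α + 48 * (-(2 / 3) * ϖ * deriv (KF₂ α) ϖ) + 72) := by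
  rw [(hasDerivAt_KF₂ hα₀ hϖ).deriv]
  have hR : 0 ≤ α ^ 2 + 6 * α * ϖ + ϖ ^ 2 + 8 * ϖ := by positivity
  have hW := Real.sq_sqrt hR
  generalize Real.sqrt _ = W at *
  field_simp
  linear_combination 20736 * hW
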